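/- arXiv:2009.11329 — 9 statements merged into one kernel-verified Lean document; each statement's English description precedes it below -/
import Mathlib

section
/- Let N and s be natural numbers with N/2 < s < N and set z = ⌈s/(N-s)⌉. Let G be an additive commutative group and let x : ZMod N → Fin z → G assign to each message index l its z blocks x(l,0),...,x(l,z-1). Define coded symbols Y : ZMod N → G by Y(j) = ∑_{k=0}^{z-1} x((j + k(N-s)) mod N, k). Then for all indices j, l ∈ ZMod N with (l - j) mod N ≥ s and every block index i ∈ {0,...,z-1}, both of the following hold: (a) x(l, i) = Y((l - i(N-s)) mod N) − ∑_{k=0, k≠i}^{z-1} x((l + (k-i)(N-s)) mod N, k); and (b) for every k ∈ {0,...,z-1} with k ≠ i, ((l + (k-i)(N-s)) − j) mod N ≤ s − 1. In other words, every user recovers every block of every message outside its side-information from the coded symbols and the blocks of its side-information messages. -/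
/-- A block of nonzero offset `m`, with `|m| * d < N - d`, moves a residue from the top `d`
residues modulo `N` to one of the remaining ones. -/
theorem ZMod.val_add_intCast_mul_lt {N : ℕ} [NeZero N] {d m : ℤ} (hd : 0 < d) (hm : m ≠ 0)
    (hmd : |m| * d < N - d) {a : ZMod N} (ha : (N : ℤ) - d ≤ a.val) :
    ((a + ((m * d : ℤ) : ZMod N)).val : ℤ) < N - d := by
  have hlt : (a.val : ℤ) < N := by exact_mod_cast a.val_lt
  have hcast : a + ((m * d : ℤ) : ZMod N) = ((a.val + m * d : ℤ) : ZMod N) := by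
    push_cast
    rw [ZMod.natCast_zmod_val]
  rw [hcast, ZMod.val_intCast]
  rcases lt_or_gt_of_ne hm with h | h
  · rw [abs_of_neg h] at hmd
    have hle : m * d ≤ -d := by nlinarith
    rw [Int.emod_eq_of_lt] <;> linarith
  · rw [abs_of_pos h] at hmd
    have hle : d ≤ m * d := by nlinarith
    rw [← Int.sub_emod_right, Int.emod_eq_of_lt] <;> linarith

/-- Decoding of Construction 1 for CS-EICP (case N/2 < s < N).
With z = ⌈s/(N-s)⌉ blocks per message and coded symbols
Y j = ∑_{k=0}^{z-1} x((j + k(N-s)) mod N, k), every user S_j recovers every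
block x(l,i) of every demanded message x_l (i.e. (l - j) mod N ≥ s) from the
coded symbol Y((l - i(N-s)) mod N) and its side-information, since every other
block appearing in that coded symbol has message index inside the
side-information window of S_j. -/
theorem stmt_0
    (N s : ℕ) (hs : N < 2 * s) (hsN : s < N)
    (z : ℕ) (hz : (z : ℤ) = ⌈(s : ℚ) / ((N : ℚ) - (s : ℚ))⌉)
    (G : Type*) [AddCommGroup G]
    (x : ZMod N → ℕ → G)
    (Y : ZMod N → G)
    (hY : ∀ j : ZMod N, Y j = ∑ k ∈ Finset.range z, x (j + ((k * (N - s) : ℕ) : ZMod N)) k)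
    (j l : ZMod N) (hjl : s ≤ (l - j).val)
    (i : ℕ) (hi : i < z) :
    (x l i = Y (l - ((i * (N - s) : ℕ) : ZMod N))
        - ∑ k ∈ (Finset.range z).erase i,
            x (l + ((((k : ℤ) - (i : ℤ)) * ((N : ℤ) - (s : ℤ)) : ℤ) : ZMod N)) k)
    ∧ ∀ k ∈ Finset.range z, k ≠ i →
        ((l + ((((k : ℤ) - (i : ℤ)) * ((N : ℤ) - (s : ℤ)) : ℤ) : ZMod N)) - j).val ≤ s - 1 := by
  have : NeZero N := ⟨by omega⟩
  have hd : (0 : ℤ) < N - s := by omega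
  have hzs : ((z : ℤ) - 1) * (N - s) < s := by
    have hdq : (0 : ℚ) < N - s := by exact_mod_cast hd
    have h : ((z : ℤ) : ℚ) < (s : ℚ) / (N - s) + 1 := hz ▸ Int.ceil_lt_add_one _
    have h' : ((z : ℤ) : ℚ) - 1 < (s : ℚ) / (N - s) := by linarith
    rw [lt_div_iff₀ hdq] at h'
    exact_mod_cast h'
  constructor
  · have hshift (k : ℕ) : l - ((i * (N - s) : ℕ) : ZMod N) + ((k * (N - s) : ℕ) : ZMod N)
        = l + ((((k : ℤ) - (i : ℤ)) * ((N : ℤ) - (s : ℤ)) : ℤ) : ZMod N) := by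
      push_cast [Nat.cast_sub hsN.le]
      ring
    simp only [hY, hshift]
    rw [← Finset.add_sum_erase _ _ (Finset.mem_range.mpr hi)]
    simp
  · intro k hk hki
    have hkz := Finset.mem_range.mp hk
    have habs : |(k : ℤ) - i| ≤ z - 1 := by rw [abs_le]; omega
    have hlt := ZMod.val_add_intCast_mul_lt (a := l - j) (m := (k : ℤ) - i) hd (by omega)
      (by nlinarith) (by omega)
    rw [add_sub_right_comm]
    omega
end

section
/- Let N and s be natural numbers with N/2 < s < N and set z = ⌈s/(N-s)⌉. For every natural number l with s ≤ l ≤ N − 1 and all integers i, k with 0 ≤ i ≤ z − 1, 0 ≤ k ≤ z − 1 and k ≠ i, the residue (l + (k − i)(N − s)) mod N lies in {0, 1, ..., s − 1}. -/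
/-- For N/2 < s < N, z = ⌈s/(N-s)⌉, s ≤ l ≤ N-1 and integers
0 ≤ i,k ≤ z-1 with k ≠ i, the residue (l + (k-i)(N-s)) mod N lies in
{0,1,...,s-1}. -/
theorem stmt_2
    (N s : ℕ) (hs : N < 2 * s) (hsN : s < N)
    (z : ℕ) (hz : (z : ℤ) = ⌈(s : ℚ) / ((N : ℚ) - (s : ℚ))⌉)
    (l : ℕ) (hl1 : s ≤ l) (hl2 : l ≤ N - 1)
    (i k : ℤ) (hi0 : 0 ≤ i) (hi1 : i ≤ (z : ℤ) - 1)
    (hk0 : 0 ≤ k) (hk1 : k ≤ (z : ℤ) - 1) (hki : k ≠ i) :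
    0 ≤ ((l : ℤ) + (k - i) * ((N : ℤ) - (s : ℤ))) % (N : ℤ)
    ∧ ((l : ℤ) + (k - i) * ((N : ℤ) - (s : ℤ))) % (N : ℤ) ≤ (s : ℤ) - 1 := by
  have hdQ : (0 : ℚ) < (N : ℚ) - (s : ℚ) := sub_pos.mpr (by exact_mod_cast hsN)
  have hzlt : (z : ℤ) - 1 < ⌈(s : ℚ) / ((N : ℚ) - (s : ℚ))⌉ := by omega
  rw [Int.lt_ceil, lt_div_iff₀ hdQ] at hzlt
  have hzd : ((z : ℤ) - 1) * ((N : ℤ) - (s : ℤ)) < (s : ℤ) := by exact_mod_cast hzlt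
  have hd : (0 : ℤ) < (N : ℤ) - (s : ℤ) := by omega
  have hlN : (l : ℤ) ≤ (N : ℤ) - 1 := by omega
  have hsl : (s : ℤ) ≤ (l : ℤ) := by exact_mod_cast hl1
  refine ⟨Int.emod_nonneg _ (by omega), ?_⟩
  rcases lt_or_gt_of_ne hki with h | h
  · have hlow : (i - k) * ((N : ℤ) - s) ≤ ((z : ℤ) - 1) * ((N : ℤ) - s) :=
      mul_le_mul_of_nonneg_right (by omega) hd.le
    have hhigh : 1 * ((N : ℤ) - s) ≤ (i - k) * ((N : ℤ) - s) :=
      mul_le_mul_of_nonneg_right (by omega) hd.le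
    rw [Int.emod_eq_of_lt (by linarith) (by linarith)]
    linarith
  · have hhigh : (k - i) * ((N : ℤ) - s) ≤ ((z : ℤ) - 1) * ((N : ℤ) - s) :=
      mul_le_mul_of_nonneg_right (by omega) hd.le
    have hlow : 1 * ((N : ℤ) - s) ≤ (k - i) * ((N : ℤ) - s) :=
      mul_le_mul_of_nonneg_right (by omega) hd.le
    rw [← Int.sub_emod_right, Int.emod_eq_of_lt (by linarith) (by linarith)]
    linarith
end

section
/- Let N and s be natural numbers with 2 ≤ s ≤ N/2 and set z = 1 + ⌈(N-s)/(s-1)⌉. Let G be an additive commutative group in which g + g = 0 for every g ∈ G, and let x : ZMod N → Fin z → G assign to each message index its z blocks. For each iteration i ∈ ZMod N and each k ∈ {0,...,z−2} define the coded symbol Y(k, i) = x((k(s−1) + i) mod N, k) + x(((k+1)(s−1) + i) mod N, k+1). Then for every l ∈ ZMod N and all natural numbers i₁, t with t ≥ 1 and i₁ + t ≤ z − 1, writing l₁ = (l − i₁(s−1)) mod N, one has ∑_{k=i₁}^{i₁+t−1} Y(k, l₁) = x(l, i₁) + x((l + t(s−1)) mod N, i₁ + t). -/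
/-- Telescoping identity for the coded symbols of Construction 2
of CS-EICP (case 2 ≤ s ≤ N/2, z = 1 + ⌈(N-s)/(s-1)⌉ blocks per message), in an
abelian group of exponent 2 (modeling XOR): with
Y(k,i) = x((k(s-1)+i) mod N, k) + x(((k+1)(s-1)+i) mod N, k+1), for every l,
every t ≥ 1 and i₁ with i₁ + t ≤ z - 1, writing l₁ = (l - i₁(s-1)) mod N,
∑_{k=i₁}^{i₁+t-1} Y(k, l₁) = x(l, i₁) + x((l + t(s-1)) mod N, i₁+t). -/
theorem stmt_3
    (N s : ℕ) (hs : 2 ≤ s) (hsN : 2 * s ≤ N)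
    (z : ℕ) (hz : (z : ℤ) = 1 + ⌈((N : ℚ) - (s : ℚ)) / ((s : ℚ) - 1)⌉)
    (G : Type*) [AddCommGroup G] (hG : ∀ g : G, g + g = 0)
    (x : ZMod N → ℕ → G)
    (Y : ℕ → ZMod N → G)
    (hY : ∀ i : ZMod N, ∀ k, k ≤ z - 2 →
      Y k i = x (((k * (s - 1) : ℕ) : ZMod N) + i) k
            + x ((((k + 1) * (s - 1) : ℕ) : ZMod N) + i) (k + 1))
    (l : ZMod N) (i₁ t : ℕ) (ht : 1 ≤ t) (hit : i₁ + t ≤ z - 1) :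
    ∑ k ∈ Finset.Ico i₁ (i₁ + t), Y k (l - ((i₁ * (s - 1) : ℕ) : ZMod N))
      = x l i₁ + x (l + ((t * (s - 1) : ℕ) : ZMod N)) (i₁ + t) := by
  induction t, ht using Nat.le_induction with
  | base =>
    rw [Nat.Ico_succ_singleton, Finset.sum_singleton, hY _ _ (by omega)]
    congr 2 <;> push_cast <;> ring
  | succ t ht ih =>
    have hfst : ((((i₁ + t) * (s - 1) : ℕ) : ZMod N) + (l - ((i₁ * (s - 1) : ℕ) : ZMod N)))
        = l + ((t * (s - 1) : ℕ) : ZMod N) := by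
      push_cast; ring
    have hsnd : ((((i₁ + t + 1) * (s - 1) : ℕ) : ZMod N) + (l - ((i₁ * (s - 1) : ℕ) : ZMod N)))
        = l + (((t + 1) * (s - 1) : ℕ) : ZMod N) := by
      push_cast; ring
    rw [← add_assoc, Finset.sum_Ico_succ_top (by omega), ih (by omega), hY _ _ (by omega),
      hfst, hsnd, add_assoc, ← add_assoc (x _ (i₁ + t)), hG, zero_add]
end

section
/- Let N and s be natural numbers with 2 ≤ s < N. Let j and l be integers and set r = (j − l) mod N, and suppose 1 ≤ r ≤ N − s (equivalently, s ≤ (l − j) mod N ≤ N − 1). Let t₁ = ⌈r/(s−1)⌉. Then: (a) 1 ≤ t₁ ≤ ⌈(N−s)/(s−1)⌉, and (b) ((l + t₁(s−1)) − j) mod N ≤ s − 1, i.e., the message x_{(l + t₁(s−1)) mod N} lies in the side-information window {j, j+1, ..., j+s−1} (mod N) of user S_j. -/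
/-- For 2 ≤ s < N, integers j, l with r = (j - l) mod N satisfying
1 ≤ r ≤ N - s, and t₁ = ⌈r/(s-1)⌉, one has (a) 1 ≤ t₁ ≤ ⌈(N-s)/(s-1)⌉ and
(b) ((l + t₁(s-1)) - j) mod N ≤ s - 1, i.e. the message x_{(l+t₁(s-1)) mod N}
lies in the side-information window {j,...,j+s-1} (mod N) of user S_j. -/
theorem stmt_4
    (N s : ℕ) (hs : 2 ≤ s) (hsN : s < N)
    (j l : ℤ) (r : ℤ) (hr : r = (j - l) % (N : ℤ))
    (hr1 : 1 ≤ r) (hr2 : r ≤ (N : ℤ) - (s : ℤ))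
    (t₁ : ℤ) (ht : t₁ = ⌈(r : ℚ) / ((s : ℚ) - 1)⌉) :
    (1 ≤ t₁ ∧ t₁ ≤ ⌈((N : ℚ) - (s : ℚ)) / ((s : ℚ) - 1)⌉)
    ∧ ((l + t₁ * ((s : ℤ) - 1)) - j) % (N : ℤ) ≤ (s : ℤ) - 1 := by
  have hs0 : (0 : ℚ) < (s : ℚ) - 1 := by
    have : (2 : ℚ) ≤ s := by exact_mod_cast hs
    linarith
  refine ⟨⟨?_, ?_⟩, ?_⟩
  · rw [ht, Int.one_le_ceil_iff]
    have : (1 : ℚ) ≤ r := by exact_mod_cast hr1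
    positivity
  · rw [ht]
    apply Int.ceil_mono
    have : (r : ℚ) ≤ (N : ℚ) - s := by exact_mod_cast hr2
    gcongr
  · have lower : r ≤ t₁ * ((s : ℤ) - 1) := by
      have := (div_le_iff₀ hs0).1 (Int.le_ceil ((r : ℚ) / ((s : ℚ) - 1)))
      rw [← ht] at this
      exact_mod_cast this
    have upper : (t₁ - 1) * ((s : ℤ) - 1) < r := by
      have := (lt_div_iff₀ hs0).1
        (sub_lt_iff_lt_add.2 (Int.ceil_lt_add_one ((r : ℚ) / ((s : ℚ) - 1))))
      rw [← ht] at this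
      exact_mod_cast this
    have hmod : (l + t₁ * ((s : ℤ) - 1) - j) =
        (t₁ * ((s : ℤ) - 1) - r) + N * (-((j - l) / (N : ℤ))) := by
      linarith [Int.emod_add_mul_ediv (j - l) N]
    rw [hmod, Int.add_mul_emod_self_left, Int.emod_eq_of_lt] <;> linarith
end

section
/- Let N and s be natural numbers with 2 ≤ s ≤ N/2 and set z = 1 + ⌈(N-s)/(s-1)⌉. Let G be an additive commutative group in which g + g = 0 for every g ∈ G, let x : ZMod N → Fin z → G assign to each message index its z blocks, and define the coded symbols Y(k, i) = x((k(s−1)+i) mod N, k) + x(((k+1)(s−1)+i) mod N, k+1) for i ∈ ZMod N and k ∈ {0,...,z−2}. Let j, l be indices with r = (j − l) mod N satisfying 1 ≤ r ≤ N − s, and let t₁ = ⌈r/(s−1)⌉. Then for every i₁ with 0 ≤ i₁ ≤ z − 1 − t₁, writing l₁ = (l − i₁(s−1)) mod N, one has x(l, i₁) = ∑_{k=i₁}^{i₁+t₁−1} Y(k, l₁) + x((l + t₁(s−1)) mod N, i₁ + t₁), where the index ((l + t₁(s−1)) − j) mod N ≤ s − 1, so the correction block belongs to user S_j's side-information; hence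 user S_j recovers the block x(l, i₁) from the coded symbols and its side-information. -/
/-- Telescoping a chain of coded symbols in a group of exponent two. -/
theorem eq_sum_Ico_add_of_exponent_two {G : Type*} [AddCommGroup G] (hG : ∀ g : G, g + g = 0)
    (a y : ℕ → G) (m n : ℕ) (hy : ∀ k, m ≤ k → k < m + n → y k = a k + a (k + 1)) :
    a m = ∑ k ∈ Finset.Ico m (m + n), y k + a (m + n) := by
  induction n with
  | zero => simp
  | succ n ih =>
    rw [ih fun k h1 h2 => hy k h1 (by omega), ← add_assoc m n 1,
      Finset.sum_Ico_succ_top (by omega), hy (m + n) (by omega) (by omega)]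
    simp only [add_assoc, hG, add_zero]

/-- The least multiple of `d` that is at least `r` exceeds `r` by less than `d`. -/
theorem le_mul_and_mul_lt_of_eq_ceil_div {r d t : ℕ} (hd : 0 < d)
    (ht : (t : ℤ) = ⌈(r : ℚ) / (d : ℚ)⌉) : r ≤ t * d ∧ t * d < r + d := by
  have hd' : (0 : ℚ) < d := by exact_mod_cast hd
  obtain ⟨h1, h2⟩ := Int.ceil_eq_iff.mp ht.symm
  rw [div_le_iff₀ hd'] at h2
  rw [lt_div_iff₀ hd', sub_mul, one_mul, sub_lt_iff_lt_add] at h1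
  exact ⟨by exact_mod_cast h2, by exact_mod_cast h1⟩


/-- Decoding of Construction 2 for CS-EICP (case 2 ≤ s ≤ N/2,
z = 1 + ⌈(N-s)/(s-1)⌉, XOR modeled by an abelian group of exponent 2).
For user S_j and demanded message x_l with r = (j - l) mod N, 1 ≤ r ≤ N - s,
and t₁ = ⌈r/(s-1)⌉, for every block index i₁ with 0 ≤ i₁ ≤ z - 1 - t₁, writing
l₁ = (l - i₁(s-1)) mod N,
x(l,i₁) = ∑_{k=i₁}^{i₁+t₁-1} Y(k,l₁) + x((l + t₁(s-1)) mod N, i₁+t₁), where the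
correction block has message index in the side-information window of S_j. -/
theorem stmt_5
    (N s : ℕ) (hs : 2 ≤ s) (hsN : 2 * s ≤ N)
    (z : ℕ) (hz : (z : ℤ) = 1 + ⌈((N : ℚ) - (s : ℚ)) / ((s : ℚ) - 1)⌉)
    (G : Type*) [AddCommGroup G] (hG : ∀ g : G, g + g = 0)
    (x : ZMod N → ℕ → G)
    (Y : ℕ → ZMod N → G)
    (hY : ∀ i : ZMod N, ∀ k, k ≤ z - 2 →
      Y k i = x (((k * (s - 1) : ℕ) : ZMod N) + i) k
            + x ((((k + 1) * (s - 1) : ℕ) : ZMod N) + i) (k + 1))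
    (j l : ZMod N) (r : ℕ) (hr : r = (j - l).val) (hr1 : 1 ≤ r) (hr2 : r ≤ N - s)
    (t₁ : ℕ) (ht : (t₁ : ℤ) = ⌈(r : ℚ) / ((s : ℚ) - 1)⌉)
    (i₁ : ℕ) (hi₁ : i₁ + t₁ ≤ z - 1) :
    x l i₁ = ∑ k ∈ Finset.Ico i₁ (i₁ + t₁), Y k (l - ((i₁ * (s - 1) : ℕ) : ZMod N))
        + x (l + ((t₁ * (s - 1) : ℕ) : ZMod N)) (i₁ + t₁)
    ∧ ((l + ((t₁ * (s - 1) : ℕ) : ZMod N)) - j).val ≤ s - 1 := by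
  have hs1 : ((s : ℚ) - 1) = ((s - 1 : ℕ) : ℚ) := by
    rw [Nat.cast_sub (by omega), Nat.cast_one]
  rw [hs1] at ht
  obtain ⟨h1, h2⟩ := le_mul_and_mul_lt_of_eq_ceil_div (by omega) ht
  have : NeZero N := ⟨by omega⟩
  constructor
  · have key := eq_sum_Ico_add_of_exponent_two hG
      (fun k => x (((k * (s - 1) : ℕ) : ZMod N) + (l - ((i₁ * (s - 1) : ℕ) : ZMod N))) k)
      (fun k => Y k (l - ((i₁ * (s - 1) : ℕ) : ZMod N))) i₁ t₁
      (fun k _ hk => hY _ k (by omega))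
    have e1 : ((i₁ * (s - 1) : ℕ) : ZMod N) + (l - ((i₁ * (s - 1) : ℕ) : ZMod N)) = l := by
      ring
    have e2 : (((i₁ + t₁) * (s - 1) : ℕ) : ZMod N) + (l - ((i₁ * (s - 1) : ℕ) : ZMod N))
        = l + ((t₁ * (s - 1) : ℕ) : ZMod N) := by
      rw [add_mul, Nat.cast_add]
      ring
    simpa only [e1, e2] using key
  · have hjl : j - l = (r : ZMod N) := by rw [hr, ZMod.natCast_zmod_val]
    have e : l + ((t₁ * (s - 1) : ℕ) : ZMod N) - j = ((t₁ * (s - 1) - r : ℕ) : ZMod N) := by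
      rw [Nat.cast_sub h1, ← hjl]
      ring
    rw [e, ZMod.val_natCast_of_lt (by omega)]
    omega
end

section
/- Let N and s be natural numbers with 2 ≤ s ≤ N − 1, and define the normalized rate C(s) as a real number by C(s) = 1/⌈s/(N−s)⌉ if s > N/2, and C(s) = ⌈(N−s)/(s−1)⌉ / (1 + ⌈(N−s)/(s−1)⌉) if s ≤ N/2. If (s − 1) divides (N − 1), or (N − s) divides (N − 1), or s > (2N + 1 − √(4N+1))/2, then C(s) < (N − s + 1)/N. -/
lemma add_lt_succ_mul_of_le_mul {s d c : ℕ} (hs : 2 ≤ s) (hd : 1 ≤ d) (hds : d < s)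
    (hc : s ≤ c * d) (h : (s - 1) ∣ d ∨ d ∣ (s - 1) ∨ d ^ 2 < s) :
    s + d < (d + 1) * c := by
  rcases h with h | ⟨k, hk⟩ | h
  · have hle := Nat.le_of_dvd hd h
    have : 2 ≤ c := by
      by_contra! hlt
      nlinarith
    calc s + d < (d + 1) * 2 := by omega
      _ ≤ (d + 1) * c := Nat.mul_le_mul_left _ this
  · obtain rfl : s = d * k + 1 := by omega
    have hk1 : 1 ≤ k := by
      by_contra! hlt
      obtain rfl : k = 0 := by omega
      omega
    have hkc : k < c := by
      by_contra! hlt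
      nlinarith
    nlinarith
  · have : d < c := by
      by_contra! hlt
      nlinarith
    nlinarith

/-- Theorem 3 of the paper: For a CS-EICP with N users/messages
and side-information size s with 2 ≤ s ≤ N-1, let C(s) = 1/⌈s/(N-s)⌉ if
s > N/2 and C(s) = ⌈(N-s)/(s-1)⌉/(1 + ⌈(N-s)/(s-1)⌉) otherwise. If
(s-1) | (N-1), or (N-s) | (N-1), or s > (2N+1-√(4N+1))/2, then
C(s) < (N-s+1)/N. -/
theorem stmt_6
    (N s : ℕ) (hs : 2 ≤ s) (hsN : s ≤ N - 1)
    (C : ℝ)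
    (hC : C = if (N : ℝ) / 2 < (s : ℝ) then
            1 / ((⌈(s : ℚ) / ((N : ℚ) - (s : ℚ))⌉ : ℤ) : ℝ)
          else ((⌈((N : ℚ) - (s : ℚ)) / ((s : ℚ) - 1)⌉ : ℤ) : ℝ)
            / (1 + ((⌈((N : ℚ) - (s : ℚ)) / ((s : ℚ) - 1)⌉ : ℤ) : ℝ)))
    (h : (s - 1) ∣ (N - 1) ∨ (N - s) ∣ (N - 1)
        ∨ (2 * (N : ℝ) + 1 - Real.sqrt (4 * (N : ℝ) + 1)) / 2 < (s : ℝ)) :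
    C < ((N : ℝ) - (s : ℝ) + 1) / (N : ℝ) := by
  obtain ⟨d, rfl⟩ : ∃ d, N = s + d := ⟨N - s, by omega⟩
  have hd : 1 ≤ d := by omega
  replace h : (s - 1) ∣ d ∨ d ∣ (s - 1) ∨ d ^ 2 < s := by
    rcases h with h | h | h
    · left
      rw [show s + d - 1 = (s - 1) + d by omega] at h
      exact (Nat.dvd_add_right dvd_rfl).1 h
    · right; left
      rw [show s + d - s = d by omega, show s + d - 1 = (s - 1) + d by omega] at h
      exact (Nat.dvd_add_left dvd_rfl).1 h
    · right; right
      push_cast at h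
      have hlt : 2 * (d : ℝ) + 1 < Real.sqrt (4 * ((s : ℝ) + d) + 1) := by linarith
      rw [Real.lt_sqrt (by positivity)] at hlt
      have : (d : ℝ) ^ 2 < s := by nlinarith
      exact_mod_cast this
  have hdQ : (0 : ℚ) < d := by exact_mod_cast hd
  have hsQ : (2 : ℚ) ≤ s := by exact_mod_cast hs
  have hN : (0 : ℝ) < (s : ℝ) + d := by positivity
  push_cast at hC ⊢
  simp only [add_sub_cancel_left] at hC ⊢
  subst hC
  split_ifs with hlt
  · have hds : d < s := by
      have : (d : ℝ) < s := by linarith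
      exact_mod_cast this
    have hpos : 0 < ⌈(s : ℚ) / d⌉ := Int.ceil_pos.2 (by positivity)
    have hle := Int.le_ceil ((s : ℚ) / d)
    generalize ⌈(s : ℚ) / d⌉ = z at hpos hle ⊢
    lift z to ℕ using hpos.le
    rw [div_le_iff₀ hdQ] at hle
    have key := add_lt_succ_mul_of_le_mul hs hd hds (by exact_mod_cast hle) h
    rw [div_lt_div_iff₀ (by exact_mod_cast hpos) hN, one_mul]
    exact_mod_cast key
  · have hsd : s ≤ d := by
      have : (s : ℝ) ≤ d := by linarith
      exact_mod_cast this
    obtain ⟨k, rfl⟩ : (s - 1) ∣ d := by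
      rcases h with h | h | h
      · exact h
      · have := Nat.le_of_dvd (by omega) h
        omega
      · nlinarith
    have hceil : ⌈(((s - 1) * k : ℕ) : ℚ) / ((s : ℚ) - 1)⌉ = (k : ℤ) := by
      have hne : (s : ℚ) - 1 ≠ 0 := by linarith
      rw [Nat.cast_mul, Nat.cast_sub (by omega), Nat.cast_one, mul_div_cancel_left₀ _ hne,
        Int.ceil_natCast]
    rw [hceil, div_lt_div_iff₀ (by positivity) hN]
    push_cast [Nat.cast_sub (show 1 ≤ s by omega)]
    nlinarith
end

section
/- Let N and s be natural numbers with 2 ≤ s, 2s ≤ N, and suppose (s − 1) divides (N − 1). Then, as real numbers, ⌈(N−s)/(s−1)⌉ / (1 + ⌈(N−s)/(s−1)⌉) < (N − s + 1)/N. -/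
/-- Case 1 of Theorem 3 for s ≤ N/2: if 2 ≤ s, 2s ≤ N and
(s-1) | (N-1), then ⌈(N-s)/(s-1)⌉ / (1 + ⌈(N-s)/(s-1)⌉) < (N-s+1)/N as
real numbers. -/
theorem stmt_10
    (N s : ℕ) (hs : 2 ≤ s) (hsN : 2 * s ≤ N) (hdvd : (s - 1) ∣ (N - 1)) :
    ((⌈((N : ℚ) - (s : ℚ)) / ((s : ℚ) - 1)⌉ : ℤ) : ℝ)
        / (1 + ((⌈((N : ℚ) - (s : ℚ)) / ((s : ℚ) - 1)⌉ : ℤ) : ℝ))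
      < ((N : ℝ) - (s : ℝ) + 1) / (N : ℝ) := by
  obtain ⟨k, hk⟩ := hdvd
  obtain ⟨t, rfl⟩ : ∃ t, s = t + 1 := ⟨s - 1, by omega⟩
  obtain rfl : N = t * k + 1 := by
    rw [Nat.add_sub_cancel] at hk
    omega
  have ht : 0 < t := by omega
  have hk0 : 0 < k := by
    rcases Nat.eq_zero_or_pos k with rfl | h
    · omega
    · exact h
  have htq : (t : ℚ) ≠ 0 := by exact_mod_cast ht.ne'
  have hq : (((t * k + 1 : ℕ) : ℚ) - ((t + 1 : ℕ) : ℚ)) / (((t + 1 : ℕ) : ℚ) - 1)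
      = (((k : ℤ) - 1 : ℤ) : ℚ) := by
    push_cast
    rw [add_sub_cancel_right, div_eq_iff htq]
    ring
  rw [hq, Int.ceil_intCast]
  have hkr : (0 : ℝ) < k := by exact_mod_cast hk0
  push_cast
  rw [add_sub_cancel, div_lt_div_iff₀ hkr (by positivity)]
  linarith
end

section
/- Let N and s be natural numbers with 2 ≤ s ≤ N − 1 and suppose (N − s) divides (N − 1). Then, as real numbers, 1/⌈s/(N−s)⌉ = (N − s)/(N − 1) < (N − s + 1)/N. -/
/-- Case 2 of Theorem 3: if 2 ≤ s ≤ N - 1 and (N-s) | (N-1),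
then 1/⌈s/(N-s)⌉ = (N-s)/(N-1) < (N-s+1)/N as real numbers. -/
theorem stmt_12
    (N s : ℕ) (hs : 2 ≤ s) (hsN : s ≤ N - 1) (hdvd : (N - s) ∣ (N - 1)) :
    (1 : ℝ) / ((⌈(s : ℚ) / ((N : ℚ) - (s : ℚ))⌉ : ℤ) : ℝ)
      = ((N : ℝ) - (s : ℝ)) / ((N : ℝ) - 1)
    ∧ ((N : ℝ) - (s : ℝ)) / ((N : ℝ) - 1) < ((N : ℝ) - (s : ℝ) + 1) / (N : ℝ) := by
  obtain ⟨d, rfl⟩ : ∃ d, N = s + d := ⟨N - s, by omega⟩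
  have hd : 0 < d := by omega
  rw [Nat.add_sub_cancel_left] at hdvd
  obtain ⟨k, hk⟩ := hdvd
  have hk' : s + d = d * k + 1 := by omega
  have hdR : (1 : ℝ) ≤ d := by exact_mod_cast hd
  have hsR : (2 : ℝ) ≤ s := by exact_mod_cast hs
  have hkR : (s : ℝ) + d = d * k + 1 := by exact_mod_cast hk'
  have hdQ : (1 : ℚ) ≤ d := by exact_mod_cast hd
  have hkQ : (s : ℚ) + d = d * k + 1 := by exact_mod_cast hk'
  have hceil : ⌈(s : ℚ) / (((s + d : ℕ) : ℚ) - (s : ℚ))⌉ = (k : ℤ) := by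
    rw [Int.ceil_eq_iff]
    push_cast
    rw [add_sub_cancel_left, lt_div_iff₀ (by linarith), div_le_iff₀ (by linarith)]
    constructor <;> linarith
  rw [hceil]
  push_cast
  constructor
  · have hden : (s : ℝ) + d - 1 = d * k := by linarith
    rw [add_sub_cancel_left, hden, div_mul_cancel_left₀ (by linarith), one_div]
  · rw [add_sub_cancel_left, div_lt_div_iff₀ (by linarith) (by linarith)]
    linarith
end

section
/- Let N and s be natural numbers with N ≥ 2, 1 ≤ s ≤ N − 1, and suppose that s > (2N + 1 − √(4N+1))/2 as real numbers. Then (N − s + 1)/N > 1/⌈s/(N−s)⌉. -/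
/-- Case 3 of Theorem 3: for N ≥ 2, 1 ≤ s ≤ N - 1, if
s > (2N+1-√(4N+1))/2 as real numbers, then (N-s+1)/N > 1/⌈s/(N-s)⌉. -/
theorem stmt_16
    (N s : ℕ) (hN : 2 ≤ N) (hs : 1 ≤ s) (hsN : s ≤ N - 1)
    (h : (2 * (N : ℝ) + 1 - Real.sqrt (4 * (N : ℝ) + 1)) / 2 < (s : ℝ)) :
    ((N : ℝ) - (s : ℝ) + 1) / (N : ℝ)
      > 1 / ((⌈(s : ℚ) / ((N : ℚ) - (s : ℚ))⌉ : ℤ) : ℝ) := by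
  have hlt : s < N := by omega
  obtain ⟨k, rfl⟩ : ∃ k, N = s + k := ⟨N - s, by omega⟩
  have hk : 0 < k := by omega
  have hkR : (0 : ℝ) < k := by exact_mod_cast hk
  have hsR : (0 : ℝ) < s := by exact_mod_cast hs
  push_cast at h ⊢
  have hsq : (2 * (k : ℝ) + 1) ^ 2 < 4 * ((s : ℝ) + k) + 1 :=
    Real.lt_sqrt (by positivity) |>.mp (by linarith)
  have hks : (k : ℝ) * k < s := by nlinarith
  have hceil : (s : ℝ) / k ≤ (⌈(s : ℚ) / ((s : ℚ) + k - s)⌉ : ℤ) := by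
    have hle := Int.le_ceil ((s : ℚ) / ((s : ℚ) + k - s))
    have hden : (s : ℚ) + k - s = k := by ring
    rw [hden] at hle ⊢
    generalize ⌈(s : ℚ) / k⌉ = m at hle ⊢
    have hleR : (((s : ℚ) / k : ℚ) : ℝ) ≤ ((m : ℚ) : ℝ) := Rat.cast_le.mpr hle
    simpa using hleR
  set c : ℝ := ((⌈(s : ℚ) / ((s : ℚ) + k - s)⌉ : ℤ) : ℝ)
  have hsc : (s : ℝ) ≤ c * k := (div_le_iff₀ hkR).mp hceil
  have hkc : (k : ℝ) < c := ((lt_div_iff₀ hkR).mpr hks).trans_le hceil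
  rw [gt_iff_lt, div_lt_div_iff₀ (hkR.trans hkc) (by positivity)]
  linarith
end
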